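/- Let R be a commutative ring, let k' ≥ 1 and k'' ≥ 1 be integers, let A be a k'×k' matrix over R and B a k''×k'' matrix over R. Let M be the (k'+k''−1)×(k'+k'') matrix whose rows are: for 1 ≤ l ≤ k'−1 the row (row l of A, 0) (zero in the last k'' entries); the k'-th row (row k' of A, row 1 of B); and for 1 ≤ m ≤ k''−1 the row (0, row m+1 of B) (zero in the first k' entries). Then for every i with 1 ≤ i ≤ k', the determinant of the square matrix obtained from M by deleting its i-th column equals det(A') · det(B), where A' is the (k'−1)×(k'−1) matrix formed by the first k'−1 rows of A with its i-th column deleted. -/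

import Mathlib

open Matrix

/-- The `(k'+k''-1) × (k'+k'')` matrix (with `k' = p+1`, `k'' = q+1`) whose first `p`
rows are `(row l of A, 0)`, whose `(p+1)`-st row is `(row p of A, row 0 of B)`, and whose
last `q` rows are `(0, row (i-p) of B)`. -/
def comboMatrix {R : Type*} [CommRing R] (p q : ℕ)
    (A : Matrix (Fin (p + 1)) (Fin (p + 1)) R)
    (B : Matrix (Fin (q + 1)) (Fin (q + 1)) R) :
    Matrix (Fin (p + q + 1)) (Fin (p + q + 2)) R :=
  Matrix.of fun i j =>
    if hi : (i : ℕ) < p then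
      if hj : (j : ℕ) < p + 1 then A ⟨i, by omega⟩ ⟨j, hj⟩ else 0
    else if (i : ℕ) = p then
      if hj : (j : ℕ) < p + 1 then A ⟨p, by omega⟩ ⟨j, hj⟩
      else B ⟨0, by omega⟩ ⟨(j : ℕ) - (p + 1), by have := j.isLt; omega⟩
    else
      if hj : (j : ℕ) < p + 1 then 0
      else B ⟨(i : ℕ) - p, by have := i.isLt; omega⟩
             ⟨(j : ℕ) - (p + 1), by have := j.isLt; omega⟩

/-- Deleting the `i`-th column (a column of the `A`-block) of the combined matrix yields a
square matrix whose determinant is `det A' * det B`, where `A'` consists of the first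
`k'-1 = p` rows of `A` with the `i`-th column deleted. -/
theorem det_comboMatrix_deleteColumn_left {R : Type*} [CommRing R] (p q : ℕ)
    (A : Matrix (Fin (p + 1)) (Fin (p + 1)) R)
    (B : Matrix (Fin (q + 1)) (Fin (q + 1)) R)
    (i : Fin (p + 1)) :
    ((comboMatrix p q A B).submatrix id
        (Fin.succAbove
          (⟨(i : ℕ), by have := i.isLt; omega⟩ : Fin (p + q + 2)))).det
      = (A.submatrix Fin.castSucc i.succAbove).det * B.det := by
  let e : Fin p ⊕ Fin (q + 1) ≃ Fin (p + q + 1) := finSumFinEquiv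
  set N := (comboMatrix p q A B).submatrix id
    (Fin.succAbove (⟨(i : ℕ), by have := i.isLt; omega⟩ : Fin (p + q + 2))) with hN
  have el (a : Fin p) : (e (Sum.inl a) : ℕ) = a := by simp [e]
  have er (b : Fin (q + 1)) : (e (Sum.inr b) : ℕ) = p + b := by simp [e]
  have cl (a : Fin p) : (Fin.succAbove (⟨(i : ℕ), by have := i.isLt; omega⟩ : Fin (p + q + 2))
      (e (Sum.inl a)) : ℕ) = i.succAbove a := by
    simp only [Fin.succAbove, Fin.lt_def, Fin.val_castSucc, el]
    split_ifs <;> simp [el]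
  have cr (b : Fin (q + 1)) : (Fin.succAbove
      (⟨(i : ℕ), by have := i.isLt; omega⟩ : Fin (p + q + 2)) (e (Sum.inr b)) : ℕ) =
        b + (p + 1) := by
    have := i.isLt
    simp only [Fin.succAbove, Fin.lt_def, Fin.val_castSucc, er]
    rw [if_neg (by omega), Fin.val_succ, er]
    omega
  have hc (b : ℕ) : ¬ b + (p + 1) ≤ p := by omega
  have blocks : N.submatrix e e = fromBlocks (A.submatrix Fin.castSucc i.succAbove) 0
      (N.submatrix e e).toBlocks₂₁ B := by
    ext (a | a) (b | b)
    · simp [hN, comboMatrix, el, cl, Nat.le_of_lt_succ (i.succAbove b).isLt]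
      rfl
    · simp [hN, comboMatrix, el, cr, hc]
    · rfl
    · by_cases h : (a : ℕ) = 0
      · obtain rfl : a = 0 := Fin.ext h
        simp [hN, comboMatrix, er, cr, hc]
      · simp [hN, comboMatrix, er, cr, hc, h]
  rw [← det_submatrix_equiv_self e N, blocks, det_fromBlocks_zero₁₂]
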